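/- Let D and S be hermitian complex N×N matrices with S² = I and SD = −DS, and let μ be a nonzero real number. Then dim_ℂ(V_μ ∩ E_+) = dim_ℂ(V_μ ∩ E_−), where V_μ is the eigenspace of D² for the eigenvalue μ and E_+, E_− are the eigenspaces of S for the eigenvalues +1 and −1 respectively. -/

import Mathlib

/-- If `s` anticommutes with `d` and `μ ≠ 0`, then `d` embeds the part of the `μ`-eigenspace of `d²`
lying in the `c`-eigenspace of `s` into the part lying in the `-c`-eigenspace. -/
theorem Module.End.finrank_eigenspace_inf_le_of_anticommute {K V : Type*} [Field K]
    [AddCommGroup V] [Module K V] [FiniteDimensional K V] {d s : Module.End K V}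
    (h : s * d = -(d * s)) {μ : K} (hμ : μ ≠ 0) (c : K) :
    Module.finrank K ↥(eigenspace (d * d) μ ⊓ eigenspace s c) ≤
      Module.finrank K ↥(eigenspace (d * d) μ ⊓ eigenspace s (-c)) := by
  have hmaps : ∀ v ∈ eigenspace (d * d) μ ⊓ eigenspace s c,
      d v ∈ eigenspace (d * d) μ ⊓ eigenspace s (-c) := by
    rintro v ⟨hv, hsv⟩
    rw [SetLike.mem_coe, mem_eigenspace_iff] at hv hsv
    rw [Module.End.mul_apply] at hv
    refine ⟨mem_eigenspace_iff.2 ?_, mem_eigenspace_iff.2 ?_⟩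
    · rw [Module.End.mul_apply, hv, map_smul]
    · have hsd : s (d v) = -d (s v) := LinearMap.congr_fun h v
      rw [hsd, hsv, map_smul, neg_smul]
  refine LinearMap.finrank_le_finrank_of_injective (f := d.restrict hmaps) ?_
  rw [injective_iff_map_eq_zero]
  rintro ⟨v, hv, hsv⟩ h0
  have hdv : d v = 0 := congrArg Subtype.val h0
  rw [SetLike.mem_coe, mem_eigenspace_iff, Module.End.mul_apply, hdv, map_zero] at hv
  exact Subtype.ext ((smul_eq_zero.1 hv.symm).resolve_left hμ)

/-- Nonzero modes of `D²` occur in chirality pairs: for hermitian `D`, `S`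
with `S² = I`, `SD = -DS`, and a nonzero real `μ`, the eigenspace of `D²` for `μ`
meets the `+1` and `-1` eigenspaces of `S` in subspaces of equal dimension. -/
theorem nonzero_modes_chirality_pairing
    (N : ℕ) (D S : Matrix (Fin N) (Fin N) ℂ)
    (hD : D.IsHermitian) (hS : S.IsHermitian)
    (hS2 : S * S = 1) (hanti : S * D = -(D * S))
    (μ : ℝ) (hμ : μ ≠ 0) :
    Module.finrank ℂ
        ↥(Module.End.eigenspace (Matrix.mulVecLin (D * D)) ((μ : ℂ)) ⊓
          Module.End.eigenspace (Matrix.mulVecLin S) 1) =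
      Module.finrank ℂ
        ↥(Module.End.eigenspace (Matrix.mulVecLin (D * D)) ((μ : ℂ)) ⊓
          Module.End.eigenspace (Matrix.mulVecLin S) (-1)) := by
  have h : Matrix.mulVecLin S * Matrix.mulVecLin D =
      -(Matrix.mulVecLin D * Matrix.mulVecLin S) := by
    simp only [Module.End.mul_eq_comp, ← Matrix.mulVecLin_mul, hanti]
    ext1
    simp
  have hμ' : (μ : ℂ) ≠ 0 := Complex.ofReal_ne_zero.2 hμ
  rw [Matrix.mulVecLin_mul, ← Module.End.mul_eq_comp]
  refine le_antisymm (Module.End.finrank_eigenspace_inf_le_of_anticommute h hμ' 1) ?_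
  have hle := Module.End.finrank_eigenspace_inf_le_of_anticommute h hμ' (-1)
  rwa [neg_neg] at hle
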